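/- Let G be a connected decomposable claw-free graph with maximum degree 3 such that χ'_irr(G) > 3 and every decomposable claw-free graph with maximum degree at most 3 and fewer edges than G has locally irregular chromatic index at most 3. Then G has no non-trivial bridge, i.e., no bridge uv with d(u) > 1 and d(v) > 1. -/

import Mathlib

/-- A graph is *locally irregular* if no two adjacent vertices have the same degree. -/
def LocallyIrregular {V : Type*} (G : SimpleGraph V) : Prop :=
  ∀ ⦃u v : V⦄, G.Adj u v → (G.neighborSet u).ncard ≠ (G.neighborSet v).ncard

/-- `HasLIEC G k` : `G` admits a locally irregular edge-coloring using at most `k` colors,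
i.e. an assignment of one of `k` colors to every edge such that the edges of each fixed
color induce a locally irregular graph. -/
def HasLIEC {V : Type*} (G : SimpleGraph V) (k : ℕ) : Prop :=
  ∃ c : Sym2 V → Fin k, ∀ i : Fin k,
    LocallyIrregular (SimpleGraph.fromEdgeSet {e | e ∈ G.edgeSet ∧ c e = i})

/-- A graph is *decomposable* if it admits a locally irregular edge-coloring. -/
def Decomposable {V : Type*} (G : SimpleGraph V) : Prop :=
  ∃ k : ℕ, HasLIEC G k

/-- A graph is *claw-free* if it contains no induced subgraph isomorphic to `K_{1,3}`. -/
def ClawFree {V : Type*} (G : SimpleGraph V) : Prop :=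
  ¬ ∃ v a b c : V, a ≠ b ∧ a ≠ c ∧ b ≠ c ∧
      G.Adj v a ∧ G.Adj v b ∧ G.Adj v c ∧ ¬ G.Adj a b ∧ ¬ G.Adj a c ∧ ¬ G.Adj b c

/-- `G` has maximum degree at most `d`. -/
def MaxDegreeLE {V : Type*} (G : SimpleGraph V) (d : ℕ) : Prop :=
  ∀ v : V, (G.neighborSet v).ncard ≤ d

namespace LIEC

variable {V : Type*}

/-- color degree -/
noncomputable def D (G : SimpleGraph V) (c : V → V → ℕ) (k : ℕ) (x : V) : ℕ :=
  {z | G.Adj x z ∧ c x z = k}.ncard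

def Good (G : SimpleGraph V) (c : V → V → ℕ) : Prop :=
  (∀ x y, c x y = c y x) ∧ ∀ x y, G.Adj x y → D G c (c x y) x ≠ D G c (c x y) y

theorem nbr_eq (G : SimpleGraph V) {k : ℕ} (c : Sym2 V → Fin k) (i : Fin k) (x : V) :
    ((SimpleGraph.fromEdgeSet {e | e ∈ G.edgeSet ∧ c e = i}).neighborSet x).ncard
      = D G (fun x y => (c s(x, y)).val) i.val x := by
  unfold D
  congr 1
  ext z
  simp only [SimpleGraph.mem_neighborSet, SimpleGraph.fromEdgeSet_adj, Set.mem_ofPred_eq,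
    SimpleGraph.mem_edgeSet, Fin.val_inj]
  constructor
  · rintro ⟨h, _⟩; exact h
  · intro h; exact ⟨h, h.1.ne⟩

theorem hasLIEC_iff (G : SimpleGraph V) (k : ℕ) (hk : 0 < k) :
    HasLIEC G k ↔ ∃ c, Good G c ∧ ∀ x y, c x y < k := by
  constructor
  · rintro ⟨c, hc⟩
    refine ⟨fun x y => (c s(x, y)).val, ⟨?_, ?_⟩, fun x y => (c s(x, y)).isLt⟩
    · intro x y; simp only [Sym2.eq_swap]
    · intro x y h
      have := hc (c s(x, y)) (u := x) (v := y) (by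
        simp [SimpleGraph.fromEdgeSet_adj, h, h.ne])
      rw [nbr_eq, nbr_eq] at this
      exact this
  · rintro ⟨c, ⟨hs, hc⟩, hlt⟩
    refine ⟨Sym2.lift ⟨fun x y => ⟨c x y, hlt x y⟩, fun x y => by simp [hs x y]⟩, ?_⟩
    intro i u v h
    rw [nbr_eq, nbr_eq]
    simp only [SimpleGraph.fromEdgeSet_adj, Set.mem_ofPred_eq, SimpleGraph.mem_edgeSet,
      Sym2.lift_mk] at h
    obtain ⟨⟨h1, h2⟩, _⟩ := h
    subst h2
    exact hc u v h1

theorem decomposable_iff [Finite V] (G : SimpleGraph V) :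
    Decomposable G ↔ ∃ c, Good G c := by
  constructor
  · rintro ⟨k, hk⟩
    rcases Nat.eq_zero_or_pos k with rfl | hk0
    · obtain ⟨c, _⟩ := hk
      refine ⟨fun _ _ => 0, fun _ _ => rfl, fun x y _ => (c s(x, y)).elim0⟩
    · obtain ⟨c, h, _⟩ := (hasLIEC_iff G k hk0).1 hk
      exact ⟨c, h⟩
  · rintro ⟨c, h⟩
    obtain ⟨M, hM⟩ := (Set.finite_range (fun p : V × V => c p.1 p.2)).bddAbove
    refine ⟨M + 1, (hasLIEC_iff G _ (Nat.succ_pos _)).2 ⟨c, h, fun x y => ?_⟩⟩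
    exact Nat.lt_succ_of_le (hM ⟨(x, y), rfl⟩)

/-- induced graph on T with isolated vertices kept -/
def K (G : SimpleGraph V) (T : Set V) : SimpleGraph V where
  Adj x y := G.Adj x y ∧ x ∈ T ∧ y ∈ T
  symm := ⟨fun _ _ h => ⟨h.1.symm, h.2.2, h.2.1⟩⟩
  loopless := ⟨fun _ h => h.1.ne rfl⟩

theorem K_claw {G : SimpleGraph V} (h : ClawFree G) (T : Set V) : ClawFree (K G T) := by
  rintro ⟨v, a, b, c, h1, h2, h3, h4, h5, h6, h7, h8, h9⟩
  exact h ⟨v, a, b, c, h1, h2, h3, h4.1, h5.1, h6.1, fun q => h7 ⟨q, h4.2.2, h5.2.2⟩,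
    fun q => h8 ⟨q, h4.2.2, h6.2.2⟩, fun q => h9 ⟨q, h5.2.2, h6.2.2⟩⟩

theorem K_deg [Finite V] {G : SimpleGraph V} (h : MaxDegreeLE G 3) (T : Set V) :
    MaxDegreeLE (K G T) 3 := by
  intro v
  refine le_trans (Set.ncard_le_ncard ?_ (Set.toFinite _)) (h v)
  intro z hz
  exact hz.1

theorem K_edges [Finite V] {G : SimpleGraph V} (T : Set V) {x y : V} (h : G.Adj x y)
    (hT : ¬ (x ∈ T ∧ y ∈ T)) : (K G T).edgeSet.ncard < G.edgeSet.ncard := by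
  refine Set.ncard_lt_ncard ?_ (Set.toFinite _)
  refine ⟨?_, ?_⟩
  · exact SimpleGraph.edgeSet_mono (fun a b (q : (K G T).Adj a b) => q.1)
  · intro q
    have : s(x, y) ∈ (K G T).edgeSet := q h
    exact hT this.2

theorem good_comap {W : Type*} (e : W ≃ V) (G : SimpleGraph V) (c : V → V → ℕ) :
    Good G c ↔ Good (G.comap e) (fun x y => c (e x) (e y)) := by
  have key : ∀ k x, D (G.comap e) (fun x y => c (e x) (e y)) k x = D G c k (e x) := by
    intro k x
    unfold D
    rw [← Set.ncard_image_of_injective _ e.injective]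
    congr 1
    ext z
    constructor
    · rintro ⟨w, hw, rfl⟩; exact hw
    · intro h
      exact ⟨e.symm z, by simpa using h, by simp⟩
  unfold Good
  simp only [key]
  constructor
  · rintro ⟨h1, h2⟩
    exact ⟨fun x y => h1 _ _, fun x y h => h2 _ _ h⟩
  · rintro ⟨h1, h2⟩
    refine ⟨fun x y => by simpa using h1 (e.symm x) (e.symm y), fun x y h => ?_⟩
    simpa using h2 (e.symm x) (e.symm y) (by simpa using h)

theorem transfer [Fintype V] (n : ℕ)
    (hmin : ∀ (W : Type) [Fintype W] (H : SimpleGraph W),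
      Decomposable H → ClawFree H → MaxDegreeLE H 3 →
      H.edgeSet.ncard < n → HasLIEC H 3) (H : SimpleGraph V)
    (h1 : ∃ c, Good H c) (h2 : ClawFree H) (h3 : MaxDegreeLE H 3) (h4 : H.edgeSet.ncard < n) :
    ∃ c, Good H c ∧ ∀ x y, c x y < 3 := by
  let e : Fin (Fintype.card V) ≃ V := (Fintype.equivFin V).symm
  have := hmin (Fin (Fintype.card V)) (H.comap e) ?_ ?_ ?_ ?_
  · rw [hasLIEC_iff _ _ (by norm_num)] at this
    obtain ⟨c, hc, hlt⟩ := this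
    refine ⟨fun x y => c (e.symm x) (e.symm y), ?_, fun x y => hlt _ _⟩
    rw [good_comap e]
    simpa using hc
  · rw [decomposable_iff]
    obtain ⟨c, hc⟩ := h1
    exact ⟨_, (good_comap e H c).1 hc⟩
  · rintro ⟨v, a, b, c, q⟩
    exact h2 ⟨e v, e a, e b, e c, by simpa using q⟩
  · intro v
    refine le_trans (le_of_eq ?_) (h3 (e v))
    rw [← Set.ncard_image_of_injective _ e.injective]
    congr 1
    ext z
    constructor
    · rintro ⟨w, hw, rfl⟩; exact hw
    · intro h
      exact ⟨e.symm z, by simpa using h, by simp⟩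
  · refine lt_of_le_of_lt (le_of_eq ?_) h4
    exact Nat.card_congr (SimpleGraph.Iso.comap e H).mapEdgeSet

/-- only edge leaving S is uv -/
structure Cut (G : SimpleGraph V) (S : Set V) (u v : V) : Prop where
  hu : u ∈ S
  hv : v ∉ S
  adj : G.Adj u v
  cross : ∀ x y, G.Adj x y → x ∈ S → y ∉ S → x = u ∧ y = v

theorem Cut.symm {G : SimpleGraph V} {S : Set V} {u v : V} (h : Cut G S u v) :
    Cut G Sᶜ v u :=
  ⟨h.hv, fun q => q h.hu, h.adj.symm, fun x y hxy hx hy =>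
    (h.cross y x hxy.symm (by simpa using hy) hx).symm⟩

theorem glue [Finite V] {G : SimpleGraph V} {S : Set V} {u v : V} (h : Cut G S u v)
    (hdeg : MaxDegreeLE G 3)
    (h1 : ∃ c, Good (K G (S ∪ {v})) c ∧ ∀ x y, c x y < 3)
    (h2 : ∃ c, Good (K G Sᶜ) c ∧ ∀ x y, c x y < 3) :
    ∃ c, Good G c ∧ ∀ x y, c x y < 3 := by
  classical
  obtain ⟨c1, ⟨hs1, hg1⟩, hl1⟩ := h1
  obtain ⟨c2, ⟨hs2, hg2⟩, hl2⟩ := h2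
  obtain ⟨hu, hv, huv, hx⟩ := h
  -- missing color
  obtain ⟨m, hm3, hm⟩ : ∃ m, m < 3 ∧ ∀ y, G.Adj v y → y ∉ S → c2 v y ≠ m := by
    by_contra! hcon
    obtain ⟨a, ha, haS, ha0⟩ := hcon 0 (by norm_num)
    obtain ⟨b, hb, hbS, hb0⟩ := hcon 1 (by norm_num)
    obtain ⟨d, hd, hdS, hd0⟩ := hcon 2 (by norm_num)
    have hsub : ((({u, a, b, d} : Finset V) : Set V)) ⊆ G.neighborSet v := by
      intro z hz
      simp at hz
      rcases hz with rfl | rfl | rfl | rfl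
      · exact huv.symm
      · exact ha
      · exact hb
      · exact hd
    have := Set.ncard_le_ncard hsub (Set.toFinite _)
    rw [Set.ncard_coe_finset] at this
    have h4 : ({u, a, b, d} : Finset V).card = 4 := by
      rw [Finset.card_insert_of_notMem, Finset.card_insert_of_notMem,
        Finset.card_insert_of_notMem, Finset.card_singleton] <;> simp <;> grind
    have := hdeg v
    omega
  set i := c1 u v with hi
  have hi3 : i < 3 := hl1 u v
  let c : V → V → ℕ := fun x y => if x ∈ S ∨ y ∈ S then c1 x y else Equiv.swap m i (c2 x y)
  have hsw : ∀ j, j < 3 → Equiv.swap m i j < 3 := by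
    intro j hj; rw [Equiv.swap_apply_def]; split_ifs <;> assumption
  have dS : ∀ k x, x ∈ S → D G c k x = D (K G (S ∪ {v})) c1 k x := by
    intro k x hxS
    unfold D; congr 1; ext z
    simp only [Set.mem_ofPred_eq, K, c, hxS, true_or, if_true, Set.mem_union, true_and,
      Set.mem_singleton_iff]
    have := hx x z
    tauto
  have dvi : D G c i v = D (K G (S ∪ {v})) c1 i v := by
    unfold D; congr 1; ext z
    have e1 : G.Adj v z → z ∈ S → z = u := fun q w => (hx z v q.symm w hv).1
    have e2 : G.Adj v z → z ∉ S → Equiv.swap m i (c2 v z) ≠ i := by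
      intro q w r
      apply hm z q w
      rw [Equiv.swap_apply_eq_iff] at r
      simpa using r
    have e3 : G.Adj v z → z ≠ v := fun q => q.ne'
    simp only [Set.mem_ofPred_eq, K, c, Set.mem_union, Set.mem_singleton_iff]
    grind
  have dC : ∀ k x, x ∉ S → (x = v → k ≠ i) →
      D G c k x = D (K G Sᶜ) c2 (Equiv.swap m i k) x := by
    intro k x hxS hk
    unfold D; congr 1; ext z
    have e1 : G.Adj x z → z ∈ S → z = u ∧ x = v := fun q w => (hx z x q.symm w hxS)
    have e2 : Equiv.swap m i (c2 x z) = k ↔ c2 x z = Equiv.swap m i k := by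
      rw [Equiv.swap_apply_eq_iff]
    have e4 : c1 v u = i := hs1 v u
    simp only [Set.mem_ofPred_eq, K, c, Set.mem_compl_iff]
    grind
  refine ⟨c, ⟨?_, ?_⟩, ?_⟩
  · intro x y
    simp only [c, hs1 x y, hs2 x y, or_comm]
  · have main : ∀ x y, G.Adj x y → (x ∈ S ∨ y ∉ S) → D G c (c x y) x ≠ D G c (c x y) y := by
      intro x y hxy hor
      by_cases hxS : x ∈ S
      · have hc : c x y = c1 x y := by simp [c, hxS]
        by_cases hyS : y ∈ S
        · rw [dS _ _ hxS, dS _ _ hyS, hc]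
          exact hg1 x y ⟨hxy, Or.inl hxS, Or.inl hyS⟩
        · obtain ⟨rfl, rfl⟩ := hx x y hxy hxS hyS
          rw [hc, dvi, dS _ _ hxS]
          exact hg1 x y ⟨hxy, Or.inl hxS, Or.inr rfl⟩
      · have hyS : y ∉ S := by tauto
        have hc : c x y = Equiv.swap m i (c2 x y) := by simp [c, hxS, hyS]
        rw [hc, dC _ x hxS, dC _ y hyS, Equiv.swap_apply_self]
        · exact hg2 x y ⟨hxy, hxS, hyS⟩
        · rintro rfl r
          rw [Equiv.swap_apply_eq_iff, Equiv.swap_apply_right, hs2] at r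
          exact hm x hxy.symm hxS r
        · rintro rfl r
          rw [Equiv.swap_apply_eq_iff, Equiv.swap_apply_right] at r
          exact hm y hxy hyS r
    intro x y hxy
    by_cases hor : x ∈ S ∨ y ∉ S
    · exact main x y hxy hor
    · have := main y x hxy.symm (by tauto)
      have hcs : c x y = c y x := by simp only [c, hs1 x y, hs2 x y, or_comm]
      rw [hcs]; exact this.symm
  · intro x y
    simp only [c]
    split_ifs
    · exact hl1 x y
    · exact hsw _ (hl2 x y)

open Classical in
theorem D_three {G : SimpleGraph V} {x p q r : V} (hpq : p ≠ q) (hpr : p ≠ r) (hqr : q ≠ r)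
    (hN : ∀ z, G.Adj x z ↔ z = p ∨ z = q ∨ z = r) (c : V → V → ℕ) (k : ℕ) :
    D G c k x = (if c x p = k then 1 else 0) + (if c x q = k then 1 else 0)
      + (if c x r = k then 1 else 0) := by
  have : {z | G.Adj x z ∧ c x z = k} = ((({p, q, r} : Finset V).filter (fun z => c x z = k) :
      Finset V) : Set V) := by
    ext z; simp [hN]
  unfold D
  rw [this, Set.ncard_coe_finset, Finset.card_filter, Finset.sum_insert (by simp [hpq, hpr]),
    Finset.sum_insert (by simp [hqr]), Finset.sum_singleton, add_assoc]

open Classical in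
theorem D_two {G : SimpleGraph V} {x p q : V} (hpq : p ≠ q)
    (hN : ∀ z, G.Adj x z ↔ z = p ∨ z = q) (c : V → V → ℕ) (k : ℕ) :
    D G c k x = (if c x p = k then 1 else 0) + (if c x q = k then 1 else 0) := by
  have : {z | G.Adj x z ∧ c x z = k} = ((({p, q} : Finset V).filter (fun z => c x z = k) :
      Finset V) : Set V) := by
    ext z; simp [hN]
  unfold D
  rw [this, Set.ncard_coe_finset, Finset.card_filter, Finset.sum_insert (by simp [hpq]),
    Finset.sum_singleton]

theorem N_three [Finite V] {G : SimpleGraph V} (hdeg : MaxDegreeLE G 3) {x p q r : V}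
    (hpq : p ≠ q) (hpr : p ≠ r) (hqr : q ≠ r) (hp : G.Adj x p) (hq : G.Adj x q)
    (hr : G.Adj x r) : ∀ z, G.Adj x z ↔ z = p ∨ z = q ∨ z = r := by
  have hsub : ({p, q, r} : Set V) ⊆ G.neighborSet x := by
    rintro z (rfl | rfl | rfl) <;> assumption
  have h3 : ({p, q, r} : Set V).ncard = 3 := by
    rw [Set.ncard_eq_three]; exact ⟨p, q, r, hpq, hpr, hqr, rfl⟩
  have := Set.eq_of_subset_of_ncard_le hsub (by rw [h3]; exact hdeg x) (Set.toFinite _)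
  intro z
  have := Set.ext_iff.1 this z
  simpa using this.symm

theorem D_le [Finite V] {G : SimpleGraph V} (hdeg : MaxDegreeLE G 3) (c : V → V → ℕ) (k : ℕ)
    (x : V) : D G c k x ≤ 3 :=
  le_trans (Set.ncard_le_ncard (fun _ h => h.1) (Set.toFinite _)) (hdeg x)

theorem D_pos [Finite V] {G : SimpleGraph V} {c : V → V → ℕ} {x y : V} (h : G.Adj x y) :
    1 ≤ D G c (c x y) x :=
  Nat.succ_le_of_lt ((Set.ncard_pos (Set.toFinite _)).2 ⟨y, h, rfl⟩)

theorem D_one [Finite V] {G : SimpleGraph V} {c : V → V → ℕ} {x y : V} {k : ℕ}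
    (h1 : D G c k x = 1) (h : G.Adj x y) (hc : c x y = k) :
    ∀ z, G.Adj x z → c x z = k → z = y := by
  obtain ⟨a, ha⟩ := Set.ncard_eq_one.1 h1
  intro z hz hzc
  have e1 : z ∈ ({a} : Set V) := ha ▸ ⟨hz, hzc⟩
  have e2 : y ∈ ({a} : Set V) := ha ▸ ⟨h, hc⟩
  rw [e1, e2]

/-- The local recoloring: `Gv` is decomposable, ordered version. -/
theorem local2 [Finite V] {G : SimpleGraph V} {S : Set V} {u v b d : V} (h : Cut G S u v)
    (hdeg : MaxDegreeLE G 3) {c : V → V → ℕ} (hc : Good G c)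
    (hub : u ≠ b) (hud : u ≠ d) (hbd : b ≠ d) (hvb : G.Adj v b) (hvd : G.Adj v d)
    (hadj : G.Adj b d) (hbS : b ∉ S) (hdS : d ∉ S)
    (cu : c v u ≠ c b d) (cb : c v b = c v u) (cd : c v d = c v u)
    (hb3 : D G c (c v u) b ≠ 3) (hjb : D G c (c b d) b = 1) (hjd : D G c (c b d) d = 2) :
    ∃ c, Good (K G Sᶜ) c := by
  classical
  obtain ⟨hs, hg⟩ := hc
  obtain ⟨hu, hv, huv, hx⟩ := h
  have hvS : ∀ z, G.Adj v z → z ≠ u → z ∉ S := fun z q w r => w (hx z v q.symm r hv).1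
  have hxS : ∀ x z, x ∉ S → x ≠ v → G.Adj x z → z ∉ S :=
    fun x z q w r t => w (hx z x r.symm t q).2
  have Nv := N_three hdeg hub hud hbd huv.symm hvb hvd
  -- third neighbor of d
  obtain ⟨d', hd', hdd', hd'b⟩ : ∃ d', G.Adj d d' ∧ c d d' = c b d ∧ d' ≠ b := by
    by_contra! hcon
    have : D G c (c b d) d ≤ ({b} : Set V).ncard :=
      Set.ncard_le_ncard (fun z hz => hcon z hz.1 hz.2) (Set.toFinite _)
    rw [Set.ncard_singleton] at this
    omega
  have hd'v : d' ≠ v := by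
    rintro rfl
    rw [hs, cd] at hdd'; exact cu hdd'
  have Nd := N_three hdeg (p := v) (q := b) (r := d') hvb.ne hd'v.symm hd'b.symm
    hvd.symm hadj.symm hd'
  have hd'S := hxS d d' hdS hvd.ne' hd'
  have Kv : ∀ z, (K G Sᶜ).Adj v z ↔ z = b ∨ z = d := by
    intro z; simp only [K, Nv, Set.mem_compl_iff]; grind
  have Kd : ∀ z, (K G Sᶜ).Adj d z ↔ z = v ∨ z = b ∨ z = d' := by
    intro z; simp only [K, Nd, Set.mem_compl_iff]; grind
  -- degrees elsewhere
  have same : ∀ c' : V → V → ℕ, ∀ x, x ∉ S → x ≠ v → (∀ z, G.Adj x z → c' x z = c x z) →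
      ∀ k, D (K G Sᶜ) c' k x = D G c k x := by
    intro c' x hxs hxv he k
    unfold D; congr 1; ext z
    simp only [K, Set.mem_ofPred_eq, Set.mem_compl_iff]
    have := hxS x z hxs hxv
    have := he z
    grind
  by_cases hib : D G c (c v u) b = 1
  · refine ⟨c, hs, ?_⟩
    have hid : D G c (c v u) d = 1 := by
      rw [D_three hvb.ne hd'v.symm hd'b.symm Nd]
      rw [hs d v, hs d b, hdd', cd]
      simp [cu.symm]
    have key : ∀ y, (K G Sᶜ).Adj v y → D (K G Sᶜ) c (c v y) v ≠ D (K G Sᶜ) c (c v y) y := by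
      intro y hy
      have h2 : D (K G Sᶜ) c (c v u) v = 2 := by
        rw [D_two hbd Kv]; simp [cb, cd]
      rcases (Kv y).1 hy with rfl | rfl
      · rw [cb, h2, same c y hbS hvb.ne' (fun _ _ => rfl), hib]; norm_num
      · rw [cd, h2, same c y hdS hvd.ne' (fun _ _ => rfl), hid]; norm_num
    intro x y hxy
    by_cases hxv : x = v
    · subst hxv; exact key y hxy
    · by_cases hyv : y = v
      · subst hyv; rw [hs]; exact (key x hxy.symm).symm
      · rw [same c x hxy.2.1 hxv (fun _ _ => rfl), same c y hxy.2.2 hyv (fun _ _ => rfl)]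
        exact hg x y hxy.1
  have hib2 : D G c (c v u) b = 2 := by
    have h1 := D_pos (c := c) hvb.symm
    rw [hs b v, cb] at h1
    have := D_le hdeg c (c v u) b
    omega
  obtain ⟨b', hb', hbb', hb'v⟩ : ∃ b', G.Adj b b' ∧ c b b' = c v u ∧ b' ≠ v := by
    by_contra! hcon
    have : D G c (c v u) b ≤ ({v} : Set V).ncard :=
      Set.ncard_le_ncard (fun z hz => hcon z hz.1 hz.2) (Set.toFinite _)
    rw [Set.ncard_singleton] at this
    omega
  have hb'd : b' ≠ d := by
    rintro rfl
    exact cu hbb'.symm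
  have hb'S := hxS b b' hbS hvb.ne' hb'
  have Nb := N_three hdeg (p := v) (q := d) (r := b') hvd.ne hb'v.symm hb'd.symm
    hvb.symm hadj hb'
  have Kb : ∀ z, (K G Sᶜ).Adj b z ↔ z = v ∨ z = d ∨ z = b' := by
    intro z; simp only [K, Nb, Set.mem_compl_iff]; grind
  have hbv := hvb.ne
  have hdv := hvd.ne
  have hb'b := hb'.ne
  have hd'd := hd'.ne
  -- general reduction for a new coloring
  have red : ∀ c' : V → V → ℕ, (∀ x y, c' x y = c' y x) →
      (∀ x y, x ≠ v → x ≠ b → x ≠ d → c' x y = c x y) →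
      (D (K G Sᶜ) c' (c' v b) v ≠ D (K G Sᶜ) c' (c' v b) b) →
      (D (K G Sᶜ) c' (c' v d) v ≠ D (K G Sᶜ) c' (c' v d) d) →
      (D (K G Sᶜ) c' (c' b d) b ≠ D (K G Sᶜ) c' (c' b d) d) →
      (D (K G Sᶜ) c' (c' b b') b ≠ D G c (c' b b') b') →
      (D (K G Sᶜ) c' (c' d d') d ≠ D G c (c' d d') d') →
      Good (K G Sᶜ) c' := by
    intro c' hs' he k1 k2 k3 k4 k5
    refine ⟨hs', ?_⟩
    have sm : ∀ x, x ∉ S → x ≠ v → x ≠ b → x ≠ d → ∀ k, D (K G Sᶜ) c' k x = D G c k x :=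
      fun x q1 q2 q3 q4 => same c' x q1 q2 (fun z _ => he x z q2 q3 q4)
    rw [← sm b' hb'S hb'v hb'b.symm hb'd] at k4
    rw [← sm d' hd'S hd'v hd'b hd'd.symm] at k5
    have half : ∀ x y, (K G Sᶜ).Adj x y → (x = v ∨ x = b ∨ x = d) →
        D (K G Sᶜ) c' (c' x y) x ≠ D (K G Sᶜ) c' (c' x y) y := by
      rintro x y hxy (rfl | rfl | rfl)
      · rcases (Kv y).1 hxy with rfl | rfl
        · exact k1
        · exact k2
      · rcases (Kb y).1 hxy with rfl | rfl | rfl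
        · rw [hs']; exact k1.symm
        · exact k3
        · exact k4
      · rcases (Kd y).1 hxy with rfl | rfl | rfl
        · rw [hs']; exact k2.symm
        · rw [hs']; exact k3.symm
        · exact k5
    intro x y hxy
    by_cases hxx : x = v ∨ x = b ∨ x = d
    · exact half x y hxy hxx
    by_cases hyy : y = v ∨ y = b ∨ y = d
    · rw [hs']; exact (half y x hxy.symm hyy).symm
    push Not at hxx hyy
    rw [sm x hxy.2.1 hxx.1 hxx.2.1 hxx.2.2, sm y hxy.2.2 hyy.1 hyy.2.1 hyy.2.2,
      he x y hxx.1 hxx.2.1 hxx.2.2]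
    exact hg x y hxy.1
  have gb := hg b b' hb'
  have gd := hg d d' hd'
  rw [hbb', hib2] at gb
  rw [hdd', hjd] at gd
  have ed1 := hs d v
  have ed2 := hs d b
  have ed3 := hs b v
  have hdb := hbd.symm
  have hvb1 := hbv.symm
  have hvd1 := hdv.symm
  have hb'v1 := hb'v.symm
  have hb'd1 := hb'd.symm
  have hb'b1 := hb'b.symm
  have hd'v1 := hd'v.symm
  have hd'b1 := hd'b.symm
  have hd'd1 := hd'd.symm
  have cu1 := cu.symm
  by_cases hd1 : D G c (c b d) d' = 1
  · let c' : V → V → ℕ := fun x y =>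
      if (x = v ∧ y = d) ∨ (x = d ∧ y = v) then c b d else c x y
    have f1 : c' v b = c v u := by simp [c', *]
    have f2 : c' v d = c b d := by simp [c']
    have f3 : c' b d = c b d := by simp [c', *]
    have f4 : c' b b' = c v u := by simp [c', *]
    have f5 : c' d d' = c b d := by simp [c', *]
    have hs' : ∀ x y, c' x y = c' y x := by
      intro x y; simp only [c', hs x y]; grind
    refine ⟨c', red c' hs' ?_ ?_ ?_ ?_ ?_ ?_⟩
    · intro x y q1 q2 q3; simp [c', q1, q3]
    all_goals
      simp only [D_two hbd Kv, D_three hdv hb'v1 hb'd1 Kb, D_three hbv hd'v1 hd'b1 Kd,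
        hs' d v, hs' d b, hs' b v, f1, f2, f3, f4, f5]
      simp [cu, cu1, hd1]
    exact gb
  · obtain ⟨M, hM1, hM2⟩ : ∃ M, M ≠ c v u ∧ M ≠ c b d :=
      ⟨c v u + c b d + 1, by omega, by omega⟩
    let c' : V → V → ℕ := fun x y =>
      if (x = v ∧ y = d) ∨ (x = d ∧ y = v) ∨ (x = b ∧ y = d) ∨ (x = d ∧ y = b) then M else c x y
    have f1 : c' v b = c v u := by simp [c', *]
    have f2 : c' v d = M := by simp [c']
    have f3 : c' b d = M := by simp [c']
    have f4 : c' b b' = c v u := by simp [c', *]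
    have f5 : c' d d' = c b d := by simp [c', *]
    have hs' : ∀ x y, c' x y = c' y x := by
      intro x y; simp only [c', hs x y]; grind
    refine ⟨c', red c' hs' ?_ ?_ ?_ ?_ ?_ ?_⟩
    · intro x y q1 q2 q3; simp [c', q1, q2, q3]
    all_goals
      simp only [D_two hbd Kv, D_three hdv hb'v1 hb'd1 Kb, D_three hbv hd'v1 hd'b1 Kd,
        hs' d v, hs' d b, hs' b v, f1, f2, f3, f4, f5]
      simp [hM1, hM2, hM1.symm, hM2.symm]
    · exact gb
    · exact fun q => hd1 q.symm

/-- The two-piece decomposition, ordered version. -/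
theorem split_lt [Finite V] {G : SimpleGraph V} {S : Set V} {u v : V} (h : Cut G S u v)
    (hclaw : ClawFree G) (hdeg : MaxDegreeLE G 3) {c : V → V → ℕ} (hc : Good G c)
    (hlt : D G c (c u v) u < D G c (c u v) v) :
    ((∃ c, Good (K G (S ∪ {v})) c) ∧ ∃ c, Good (K G Sᶜ) c) ∨
    ((∃ c, Good (K G (Sᶜ ∪ {u})) c) ∧ ∃ c, Good (K G S) c) := by
  classical
  have hcut := h
  obtain ⟨hu, hv, huv, hx⟩ := h
  have hc' := hc
  obtain ⟨hs, hg⟩ := hc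
  have hpos := D_pos (c := c) huv
  by_cases h1 : D G c (c u v) u = 1
  · right
    have hone := D_one h1 huv rfl
    constructor
    · refine ⟨c, hs, ?_⟩
      have hD : ∀ x y, (K G (Sᶜ ∪ {u})).Adj x y →
          D (K G (Sᶜ ∪ {u})) c (c x y) x = D G c (c x y) x := by
        intro x y hxy
        unfold D; congr 1; ext z
        have a1 := hx z x
        have a2 := hx x y
        have a3 := hone z
        have a4 := G.adj_comm x z
        obtain ⟨b1, b2, b3⟩ := hxy
        have a5 := b1.ne
        simp only [K, Set.mem_ofPred_eq, Set.mem_compl_iff, Set.mem_union,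
          Set.mem_singleton_iff] at *
        grind
      intro x y hxy
      rw [hD x y hxy, hs x y, hD y x hxy.symm, hs y x]
      exact hg x y hxy.1
    · refine ⟨c, hs, ?_⟩
      have hD : ∀ x y, (K G S).Adj x y →
          D (K G S) c (c x y) x = D G c (c x y) x := by
        intro x y hxy
        unfold D; congr 1; ext z
        have a1 := hx x z
        have a3 := hone y
        obtain ⟨b1, b2, b3⟩ := hxy
        simp only [K, Set.mem_ofPred_eq] at *
        grind
      intro x y hxy
      rw [hD x y hxy, hs x y, hD y x hxy.symm, hs y x]
      exact hg x y hxy.1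
  · left
    have hle := D_le hdeg c (c u v) v
    have hu2 : D G c (c u v) u = 2 := by omega
    have hv3 : D G c (c u v) v = 3 := by omega
    constructor
    · refine ⟨c, hs, ?_⟩
      have hD : ∀ x, x ∈ S → ∀ k, D (K G (S ∪ {v})) c k x = D G c k x := by
        intro x hxS k
        unfold D; congr 1; ext z
        have a1 := hx x z
        simp only [K, Set.mem_ofPred_eq, Set.mem_union, Set.mem_singleton_iff] at *
        grind
      have hDv : D (K G (S ∪ {v})) c (c u v) v = 1 := by
        unfold D
        rw [Set.ncard_eq_one]
        refine ⟨u, ?_⟩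
        ext z
        have a1 := hx z v
        have a4 := G.adj_comm v z
        have a5 : G.Adj v z → v ≠ z := fun q => q.ne
        have a6 := hs v u
        simp only [K, Set.mem_ofPred_eq, Set.mem_union, Set.mem_singleton_iff] at *
        grind
      have half : ∀ x y, (K G (S ∪ {v})).Adj x y → x ∈ S →
          D (K G (S ∪ {v})) c (c x y) x ≠ D (K G (S ∪ {v})) c (c x y) y := by
        intro x y hxy hxS
        by_cases hyS : y ∈ S
        · rw [hD x hxS, hD y hyS]; exact hg x y hxy.1
        · obtain ⟨rfl, rfl⟩ := hx x y hxy.1 hxS hyS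
          rw [hD x hxS, hDv, hu2]; norm_num
      intro x y hxy
      by_cases hxS : x ∈ S
      · exact half x y hxy hxS
      by_cases hyS : y ∈ S
      · rw [hs]; exact (half y x hxy.symm hyS).symm
      exfalso
      rcases hxy.2.1 with q | q
      · exact hxS q
      rcases hxy.2.2 with r | r
      · exact hyS r
      exact hxy.1.ne (q.trans r.symm)
    · -- neighbours of v
      have hvc : c v u = c u v := hs v u
      have hmem : u ∈ {z | G.Adj v z ∧ c v z = c u v} := ⟨huv.symm, hvc⟩
      have h2 : ({z | G.Adj v z ∧ c v z = c u v} \ {u}).ncard = 2 := by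
        rw [Set.ncard_diff_singleton_of_mem hmem]
        unfold D at hv3; omega
      obtain ⟨b, d, hbd, hset⟩ := Set.ncard_eq_two.1 h2
      have hb : b ∈ {z | G.Adj v z ∧ c v z = c u v} \ {u} := by rw [hset]; simp
      have hd : d ∈ {z | G.Adj v z ∧ c v z = c u v} \ {u} := by rw [hset]; simp
      obtain ⟨⟨hvb, cb⟩, hbu⟩ := hb
      obtain ⟨⟨hvd, cd⟩, hdu⟩ := hd
      have hub : u ≠ b := fun q => hbu q.symm
      have hud : u ≠ d := fun q => hdu q.symm
      have hbS : b ∉ S := fun q => hub (hx b v hvb.symm q hv).1.symm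
      have hdS : d ∉ S := fun q => hud (hx d v hvd.symm q hv).1.symm
      have nub : ¬ G.Adj u b := fun q => hvb.ne (hx u b q hu hbS).2.symm
      have nud : ¬ G.Adj u d := fun q => hvd.ne (hx u d q hu hdS).2.symm
      have hadj : G.Adj b d := by
        by_contra q
        exact hclaw ⟨v, u, b, d, hub, hud, hbd, huv.symm, hvb, hvd, nub, nud, q⟩
      have hb3 : D G c (c u v) b ≠ 3 := by
        have := hg v b hvb
        rw [cb, hv3] at this; exact this.symm
      have hd3 : D G c (c u v) d ≠ 3 := by
        have := hg v d hvd
        rw [cd, hv3] at this; exact this.symm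
      have two : ∀ x p q k, p ≠ q → G.Adj x p → G.Adj x q → c x p = k → c x q = k →
          2 ≤ D G c k x := by
        intro x p q k hpq hp hq cp cq
        rw [← Set.ncard_pair hpq]
        refine Set.ncard_le_ncard ?_ (Set.toFinite _)
        rintro z (rfl | rfl)
        · exact ⟨hp, cp⟩
        · exact ⟨hq, cq⟩
      have gbd := hg b d hadj
      have hne : c b d ≠ c u v := by
        intro q
        have t1 := two b v d (c u v) hvd.ne hvb.symm hadj (by rw [hs, cb]) q
        have t2 := two d v b (c u v) hvb.ne hvd.symm hadj.symm (by rw [hs, cd]) (by rw [hs, q])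
        have t3 := D_le hdeg c (c u v) b
        have t4 := D_le hdeg c (c u v) d
        rw [q] at gbd
        omega
      have lt3 : ∀ x p k, G.Adj x p → c x p ≠ k → D G c k x ≤ 2 := by
        intro x p k hp cp
        have : D G c k x < (G.neighborSet x).ncard := by
          refine Set.ncard_lt_ncard ⟨fun z hz => hz.1, fun q => cp (q hp).2⟩ (Set.toFinite _)
        have := hdeg x
        omega
      have l1 := lt3 b v (c b d) hvb.symm (by rw [hs, cb]; exact hne.symm)
      have l2 := lt3 d v (c b d) hvd.symm (by rw [hs, cd]; exact hne.symm)
      have p1 := D_pos (c := c) hadj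
      have p2 := D_pos (c := c) hadj.symm
      rw [hs d b] at p2
      rcases Nat.lt_or_gt_of_ne gbd with hl | hl
      · exact local2 hcut hdeg hc' hub hud hbd hvb hvd hadj hbS hdS (by rw [hvc]; exact hne.symm)
          (by rw [hvc, cb]) (by rw [hvc, cd]) (by rw [hvc]; exact hb3) (by omega) (by omega)
      · have e := hs d b
        exact local2 hcut hdeg hc' hud hub hbd.symm hvd hvb hadj.symm hdS hbS
          (by rw [hvc, e]; exact hne.symm)
          (by rw [hvc, cd]) (by rw [hvc, cb]) (by rw [hvc]; exact hd3) (by rw [e]; omega)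
          (by rw [e]; omega)

theorem split [Finite V] {G : SimpleGraph V} {S : Set V} {u v : V} (h : Cut G S u v)
    (hclaw : ClawFree G) (hdeg : MaxDegreeLE G 3) {c : V → V → ℕ} (hc : Good G c) :
    ((∃ c, Good (K G (S ∪ {v})) c) ∧ ∃ c, Good (K G Sᶜ) c) ∨
    ((∃ c, Good (K G (Sᶜ ∪ {u})) c) ∧ ∃ c, Good (K G S) c) := by
  rcases Nat.lt_or_gt_of_ne (hc.2 u v h.adj) with hl | hl
  · exact split_lt h hclaw hdeg hc hl
  · have := split_lt h.symm hclaw hdeg hc (by rw [hc.1 v u]; exact hl)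
    rw [compl_compl] at this
    exact this.symm

theorem finish [Fintype V] {G : SimpleGraph V} {S : Set V} {u v : V} (h : Cut G S u v)
    (hclaw : ClawFree G) (hdeg : MaxDegreeLE G 3)
    (hmin : ∀ (W : Type) [Fintype W] (H : SimpleGraph W),
      Decomposable H → ClawFree H → MaxDegreeLE H 3 →
      H.edgeSet.ncard < G.edgeSet.ncard → HasLIEC H 3)
    (hv : 1 < (G.neighborSet v).ncard)
    (h1 : ∃ c, Good (K G (S ∪ {v})) c) (h2 : ∃ c, Good (K G Sᶜ) c) : HasLIEC G 3 := by
  rw [hasLIEC_iff _ _ (by norm_num)]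
  refine glue h hdeg (transfer _ hmin _ h1 (K_claw hclaw _) (K_deg hdeg _) ?_)
    (transfer _ hmin _ h2 (K_claw hclaw _) (K_deg hdeg _) ?_)
  · obtain ⟨b, hb, hbu⟩ := Set.exists_ne_of_one_lt_ncard hv u
    refine K_edges _ hb ?_
    rintro ⟨_, q | q⟩
    · exact hbu (h.cross b v hb.symm q h.hv).1
    · exact hb.ne q.symm
  · exact K_edges _ h.adj (fun q => q.1 h.hu)

end LIEC

/-- In a minimal counterexample to the 3-color theorem for claw-free subcubic graphs, there is no non-trivial bridge, i.e., no bridge `uv` with `d(u) > 1` and `d(v) > 1`. -/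
theorem minimal_cex_no_nontrivial_bridge {V : Type*} [Fintype V] (G : SimpleGraph V)
    (hconn : G.Connected) (hdec : Decomposable G) (hclaw : ClawFree G)
    (hdeg : MaxDegreeLE G 3) (hG : ¬ HasLIEC G 3)
    (hmin : ∀ (W : Type) [Fintype W] (H : SimpleGraph W),
      Decomposable H → ClawFree H → MaxDegreeLE H 3 →
      H.edgeSet.ncard < G.edgeSet.ncard → HasLIEC H 3) :
    ¬ ∃ u v : V, G.IsBridge s(u, v) ∧
      1 < (G.neighborSet u).ncard ∧ 1 < (G.neighborSet v).ncard := by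
  rintro ⟨u, v, hb, hu, hv⟩
  apply hG
  have hadj : G.Adj u v := hb.reachable_iff_adj.1 (hconn.preconnected u v)
  have hcut : LIEC.Cut G {x | (G.deleteEdges {s(u, v)}).Reachable u x} u v := by
    refine ⟨SimpleGraph.Reachable.refl u, hb, hadj, ?_⟩
    intro x y hxy hx hy
    by_cases he : s(x, y) = s(u, v)
    · rcases Sym2.eq_iff.1 he with q | ⟨rfl, rfl⟩
      · exact q
      · exact absurd hx hb
    · exfalso
      apply hy
      have hx' : (G.deleteEdges {s(u, v)}).Reachable u x := hx
      refine hx'.trans (SimpleGraph.Adj.reachable ?_)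
      rw [SimpleGraph.deleteEdges_adj]
      exact ⟨hxy, he⟩
  obtain ⟨c, hc⟩ := (LIEC.decomposable_iff G).1 hdec
  rcases LIEC.split hcut hclaw hdeg hc with ⟨h1, h2⟩ | ⟨h1, h2⟩
  · exact LIEC.finish hcut hclaw hdeg hmin hv h1 h2
  · exact LIEC.finish hcut.symm hclaw hdeg hmin hu h1 (by rw [compl_compl]; exact h2)
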